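/- Let γ ∈ SF⁺ with q̄ = q̄(γ). For every t ∈ [0,q̄], the function x ↦ Φ_γ(t,x) is twice differentiable and satisfies −1/(1−q̄) ≤ ∂ₓ²Φ_γ(t,x) ≤ 0 for all x ∈ ℝ; in particular Φ_γ(t,·) is concave for every t ∈ [0,q̄]. (Proposition 4.1, Eq. (4.9); note the upper bound uses that the weights m_0 ≤ m_1 ≤ ⋯ ≤ m_n are non-decreasing.) -/

import Mathlib

open MeasureTheory ProbabilityTheory

/-- The standard Gaussian measure on `ℝ`. -/
noncomputable def stdGauss : Measure ℝ := gaussianReal 0 1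

/-- The Gaussian tail function `𝒩(v) = P(Z ≥ v)`. -/
noncomputable def gaussTail (v : ℝ) : ℝ := (stdGauss (Set.Ici v)).toReal

/-- A functional order parameter in `SF⁺`: a non-decreasing step function
`γ = Σ_{i=0}^n m_i · 1_{[q_i, q_{i+1})}` with `0 = q_0 < q_1 < ⋯ < q_{n+1} = 1` and
`0 = m_0 ≤ m_1 ≤ ⋯ ≤ m_n = 1`. -/
structure StepFn where
  n : ℕ
  q : ℕ → ℝ
  m : ℕ → ℝ
  q_zero : q 0 = 0
  q_last : q (n + 1) = 1
  q_lt : ∀ i ≤ n, q i < q (i + 1)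
  m_zero : m 0 = 0
  m_last : m n = 1
  m_mono : ∀ i < n, m i ≤ m (i + 1)

namespace StepFn

/-- The right end `q̄(γ) = q_n` of the support of `γ`. -/
noncomputable def qbar (γ : StepFn) : ℝ := γ.q γ.n

open Classical in
/-- `γ` as a function: `γ(s) = m_i` for `s ∈ [q_i, q_{i+1})`, and `0` outside `[0,1)`. -/
noncomputable def toFun (γ : StepFn) (s : ℝ) : ℝ :=
  if s ∈ Set.Ico (0 : ℝ) 1 then γ.m (Nat.findGreatest (fun i => γ.q i ≤ s) γ.n) else 0

end StepFn

/-- One Cole–Hopf step: given a boundary value `g` at the right end of an interval,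
spread `s` and parameter `m`, produce the value at distance `s` from the right end. -/
noncomputable def coleHopf (m s : ℝ) (g : ℝ → ℝ) (x : ℝ) : ℝ :=
  if 0 < m then (1 / m) * Real.log (∫ z, Real.exp (m * g (x + Real.sqrt s * z)) ∂stdGauss)
  else ∫ z, g (x + Real.sqrt s * z) ∂stdGauss

namespace StepFn

/-- `PhiAux γ κ j` is the solution `Φ_γ` on the interval `[q_{n-j}, q_{n-j+1})`,
built recursively downward from the terminal condition on `[q_n, 1)`. -/
noncomputable def PhiAux (γ : StepFn) (κ : ℝ) : ℕ → ℝ → ℝ → ℝ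
  | 0 => fun t x => Real.log (gaussTail ((κ - x) / Real.sqrt (1 - t)))
  | j + 1 => fun t x =>
      coleHopf (γ.m (γ.n - (j + 1))) (γ.q (γ.n - j) - t) (γ.PhiAux κ j (γ.q (γ.n - j))) x

open Classical in
/-- The solution `Φ_γ(t,x)` of the Parisi PDE for the step function `γ`:
for `t ∈ [q_i, q_{i+1})` it is given by `PhiAux γ κ (n - i)`. -/
noncomputable def Phi (γ : StepFn) (κ : ℝ) (t x : ℝ) : ℝ :=
  γ.PhiAux κ (γ.n - Nat.findGreatest (fun i => γ.q i ≤ t) γ.n) t x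

end StepFn

local notation "φ" => gaussianPDFReal 0 1

instance : IsProbabilityMeasure stdGauss := by
  unfold stdGauss; infer_instance

lemma integral_stdGauss (f : ℝ → ℝ) : ∫ z, f z ∂stdGauss = ∫ z, φ z * f z := by
  simp [stdGauss, integral_gaussianReal_eq_integral_smul (one_ne_zero)]

lemma integrable_stdGauss_iff (f : ℝ → ℝ) :
    Integrable f stdGauss ↔ Integrable (fun z => φ z * f z) := by
  rw [stdGauss, gaussianReal_of_var_ne_zero _ one_ne_zero,
    integrable_withDensity_iff_integrable_smul' (measurable_gaussianPDF _ _)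
      (ae_of_all _ fun _ => gaussianPDF_lt_top)]
  simp

lemma hasDerivAt_gaussianPDFReal (z : ℝ) : HasDerivAt φ (-(z * φ z)) z := by
  have h : HasDerivAt (fun x : ℝ => -(x - 0) ^ 2 / (2 * ((1 : NNReal) : ℝ))) (-z) z := by
    have := (((hasDerivAt_id z).sub_const 0).pow 2).neg.div_const (2 * ((1 : NNReal) : ℝ))
    refine this.congr_deriv ?_
    simp
    ring
  have h2 := h.exp.const_mul (√(2 * Real.pi * ((1 : NNReal) : ℝ)))⁻¹
  refine (h2.congr_of_eventuallyEq (Filter.Eventually.of_forall fun x => ?_)).congr_deriv ?_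
  · simp [gaussianPDFReal]
  · simp [gaussianPDFReal]; ring

lemma integrable_stdGauss_of_abs_le {f : ℝ → ℝ} (hf : Measurable f) {C : ℝ}
    (h : ∀ z, |f z| ≤ C * (1 + z ^ 2) ^ 2) : Integrable f stdGauss := by
  have h2 : Integrable (fun z : ℝ => z ^ 2) stdGauss :=
    (memLp_id_gaussianReal 2).integrable_sq
  have h4 : Integrable (fun z : ℝ => z ^ 4) stdGauss := by
    have := (memLp_id_gaussianReal (μ := 0) (v := 1) 4).integrable_norm_pow (by norm_num)
    simpa [stdGauss, Even.pow_abs (show Even 4 by decide)] using this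
  have hint : Integrable (fun z : ℝ => C * (1 + z ^ 2) ^ 2) stdGauss := by
    have : Integrable (fun z : ℝ => C * (1 + 2 * z ^ 2 + z ^ 4)) stdGauss :=
      (((integrable_const 1).add (h2.const_mul 2)).add h4).const_mul C
    refine this.congr (ae_of_all _ fun z => ?_)
    ring
  exact hint.mono' hf.aestronglyMeasurable (ae_of_all _ h)

/-- A function with at most quadratic growth. -/
def QuadGrowth (h : ℝ → ℝ) : Prop := ∃ C, 0 ≤ C ∧ ∀ y, |h y| ≤ C * (1 + y ^ 2)

lemma QuadGrowth.comp_affine_le {h : ℝ → ℝ} {C : ℝ} (hC : 0 ≤ C)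
    (hh : ∀ y, |h y| ≤ C * (1 + y ^ 2)) (r : ℝ) {R x : ℝ} (hx : |x| ≤ R) (z : ℝ) :
    |h (x + r * z)| ≤ C * (1 + 2 * R ^ 2 + 2 * r ^ 2) * (1 + z ^ 2) := by
  refine (hh _).trans ?_
  rw [mul_assoc]
  refine mul_le_mul_of_nonneg_left ?_ hC
  have h1 : x ^ 2 ≤ R ^ 2 := sq_le_sq' (abs_le.1 hx).1 (abs_le.1 hx).2
  nlinarith [sq_nonneg (x - r * z), mul_nonneg (sq_nonneg R) (sq_nonneg z), sq_nonneg z,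
    sq_nonneg r]

lemma QuadGrowth.integrable {h : ℝ → ℝ} (hh : QuadGrowth h) (hm : Measurable h) (x r : ℝ) :
    Integrable (fun z => h (x + r * z)) stdGauss := by
  obtain ⟨C, hC, hb⟩ := hh
  refine integrable_stdGauss_of_abs_le (C := C * (1 + 2 * |x| ^ 2 + 2 * r ^ 2))
    (hm.comp (by fun_prop)) fun z => ?_
  refine (QuadGrowth.comp_affine_le hC hb r le_rfl z).trans ?_
  refine mul_le_mul_of_nonneg_left ?_ (by positivity)
  nlinarith [sq_nonneg z, sq_nonneg (z ^ 2)]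

lemma QuadGrowth.integrable_id_mul {h : ℝ → ℝ} (hh : QuadGrowth h) (hm : Measurable h)
    (x r : ℝ) : Integrable (fun z => z * h (x + r * z)) stdGauss := by
  obtain ⟨C, hC, hb⟩ := hh
  refine integrable_stdGauss_of_abs_le (C := C * (1 + 2 * |x| ^ 2 + 2 * r ^ 2))
    (measurable_id.mul (hm.comp (by fun_prop))) fun z => ?_
  have h1 := QuadGrowth.comp_affine_le hC hb r le_rfl z (x := x)
  have h2 : |z| ≤ 1 + z ^ 2 := by
    rw [← sq_abs]; nlinarith [sq_nonneg (|z| - 1)]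
  rw [abs_mul]
  calc |z| * |h (x + r * z)| ≤ (1 + z ^ 2) * (C * (1 + 2 * |x| ^ 2 + 2 * r ^ 2) * (1 + z ^ 2)) :=
        mul_le_mul h2 h1 (abs_nonneg _) (by positivity)
    _ = _ := by ring

lemma measurable_of_hasDerivAt {h h' : ℝ → ℝ} (hd : ∀ y, HasDerivAt h (h' y) y) :
    Measurable h' := by
  have : h' = deriv h := funext fun y => (hd y).deriv.symm
  rw [this]; exact measurable_deriv h

lemma continuous_of_hasDerivAt {h h' : ℝ → ℝ} (hd : ∀ y, HasDerivAt h (h' y) y) :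
    Continuous h := continuous_iff_continuousAt.2 fun y => (hd y).continuousAt

lemma hasDerivAt_integral_affine {h h' : ℝ → ℝ} (hd : ∀ y, HasDerivAt h (h' y) y)
    (hh : QuadGrowth h) (hh' : QuadGrowth h') (r x : ℝ) :
    HasDerivAt (fun x => ∫ z, h (x + r * z) ∂stdGauss) (∫ z, h' (x + r * z) ∂stdGauss) x := by
  have hm : Measurable h := (continuous_of_hasDerivAt hd).measurable
  have hm' : Measurable h' := measurable_of_hasDerivAt hd
  obtain ⟨C, hC, hb⟩ := hh'
  refine (hasDerivAt_integral_of_dominated_loc_of_deriv_le (s := Metric.ball x 1)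
    (F := fun x z => h (x + r * z)) (F' := fun x z => h' (x + r * z))
    (bound := fun z => C * (1 + 2 * (|x| + 1) ^ 2 + 2 * r ^ 2) * (1 + z ^ 2))
    (Metric.ball_mem_nhds x one_pos) ?_ (hh.integrable hm x r) ?_ ?_ ?_ ?_).2
  · exact Filter.Eventually.of_forall fun y =>
      (hm.comp (by fun_prop : Measurable fun z => y + r * z)).aestronglyMeasurable
  · exact (hm'.comp (by fun_prop : Measurable fun z => x + r * z)).aestronglyMeasurable
  · refine ae_of_all _ fun z y hy => QuadGrowth.comp_affine_le hC hb r ?_ z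
    have h1 : |y - x| < 1 := by simpa [Real.dist_eq] using hy
    have h2 := abs_sub_abs_le_abs_sub y x
    linarith
  · exact ((integrable_const 1).add (memLp_id_gaussianReal 2).integrable_sq).const_mul _
  · refine ae_of_all _ fun z y _ => ?_
    simpa using! (hd (y + r * z)).comp y ((hasDerivAt_id y).add_const (r * z))

/-- Gaussian integration by parts (Stein's lemma). -/
lemma integral_id_mul_stdGauss {h h' : ℝ → ℝ} (hd : ∀ y, HasDerivAt h (h' y) y)
    (hh : QuadGrowth h) (hh' : QuadGrowth h') (x r : ℝ) :
    ∫ z, z * h (x + r * z) ∂stdGauss = r * ∫ z, h' (x + r * z) ∂stdGauss := by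
  have hm : Measurable h := (continuous_of_hasDerivAt hd).measurable
  have hm' : Measurable h' := measurable_of_hasDerivAt hd
  have hcomp : ∀ z, HasDerivAt (fun z => h (x + r * z)) (h' (x + r * z) * r) z := fun z => by
    have := (hd (x + r * z)).comp z (((hasDerivAt_id z).const_mul r).const_add x)
    simpa using! this
  have i1 := (integrable_stdGauss_iff _).1 ((hh'.integrable hm' x r).mul_const r)
  have i2 := (integrable_stdGauss_iff _).1 (hh.integrable_id_mul hm x r).neg
  have i3 := (integrable_stdGauss_iff _).1 (hh.integrable hm x r)
  have key := integral_mul_deriv_eq_deriv_mul_of_integrable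
    (u := φ) (v := fun z => h (x + r * z)) (fun z _ => hasDerivAt_gaussianPDFReal z)
    (fun z _ => hcomp z) i1 (i2.congr (ae_of_all _ fun z => by simp; ring)) i3
  rw [← integral_const_mul, integral_stdGauss, integral_stdGauss]
  calc ∫ z, φ z * (z * h (x + r * z)) = -∫ z, -(z * φ z) * h (x + r * z) := by
        rw [← integral_neg]; congr 1; ext z; ring
    _ = ∫ z, φ z * (h' (x + r * z) * r) := key.symm
    _ = _ := by congr 1; ext z; ring

/-- `g` is nonpositive and twice differentiable with `-L ≤ g'' ≤ 0`. -/
structure ConcaveBound (L : ℝ) (g : ℝ → ℝ) : Prop where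
  differentiable : Differentiable ℝ g
  differentiable_deriv : Differentiable ℝ (deriv g)
  nonpos : ∀ x, g x ≤ 0
  lower : ∀ x, -L ≤ deriv (deriv g) x
  upper : ∀ x, deriv (deriv g) x ≤ 0

namespace ConcaveBound

lemma of_hasDerivAt {L : ℝ} {g g' g'' : ℝ → ℝ} (h1 : ∀ x, HasDerivAt g (g' x) x)
    (h2 : ∀ x, HasDerivAt g' (g'' x) x) (h0 : ∀ x, g x ≤ 0) (hl : ∀ x, -L ≤ g'' x)
    (hu : ∀ x, g'' x ≤ 0) : ConcaveBound L g := by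
  have e1 : deriv g = g' := funext fun x => (h1 x).deriv
  have e2 : deriv (deriv g) = g'' := by rw [e1]; exact funext fun x => (h2 x).deriv
  refine ⟨fun x => (h1 x).differentiableAt, ?_, h0, ?_, ?_⟩
  · rw [e1]; exact fun x => (h2 x).differentiableAt
  · rw [e2]; exact hl
  · rw [e2]; exact hu

variable {L : ℝ} {g : ℝ → ℝ}

lemma antitone_deriv (hg : ConcaveBound L g) : Antitone (deriv g) :=
  antitone_of_deriv_nonpos hg.differentiable_deriv hg.upper

lemma exists_abs_deriv_le (hg : ConcaveBound L g) :
    ∃ C, 0 ≤ C ∧ L ≤ C ∧ ∀ y, |deriv g y| ≤ C * (1 + |y|) := by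
  have hL : 0 ≤ L := by linarith [hg.lower 0, hg.upper 0]
  refine ⟨|deriv g 0| + L, by positivity, by linarith [abs_nonneg (deriv g 0)], fun y => ?_⟩
  have h := Convex.norm_image_sub_le_of_norm_deriv_le (𝕜 := ℝ) (f := deriv g) (C := L)
    (s := Set.univ) (x := 0) (y := y) (fun x _ => hg.differentiable_deriv x)
    (fun x _ => by
      rw [Real.norm_eq_abs, abs_le]; exact ⟨hg.lower x, (hg.upper x).trans hL⟩)
    convex_univ trivial trivial
  simp only [Real.norm_eq_abs, sub_zero] at h
  have h2 := abs_sub_abs_le_abs_sub (deriv g y) (deriv g 0)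
  nlinarith [abs_nonneg y, mul_nonneg (abs_nonneg (deriv g 0)) (abs_nonneg y)]

lemma quadGrowth (hg : ConcaveBound L g) : QuadGrowth g := by
  obtain ⟨C, hC, -, hb⟩ := hg.exists_abs_deriv_le
  refine ⟨|g 0| + 2 * C, by positivity, fun y => ?_⟩
  have h := Convex.norm_image_sub_le_of_norm_deriv_le (𝕜 := ℝ) (f := g) (C := C * (1 + |y|))
    (s := Metric.closedBall 0 |y|) (x := 0) (y := y) (fun x _ => hg.differentiable x)
    (fun x hx => by
      rw [Real.norm_eq_abs]
      refine (hb x).trans (mul_le_mul_of_nonneg_left ?_ hC)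
      have : |x| ≤ |y| := by simpa using hx
      linarith)
    (convex_closedBall 0 |y|) (by simp) (by simp)
  simp only [Real.norm_eq_abs, sub_zero] at h
  have h2 := abs_sub_abs_le_abs_sub (g y) (g 0)
  have h3 : (1 + |y|) * |y| ≤ 2 * (1 + y ^ 2) := by
    rw [← sq_abs y]; nlinarith [sq_nonneg (|y| - 1)]
  have h4 := mul_le_mul_of_nonneg_left h3 hC
  nlinarith [mul_nonneg (abs_nonneg (g 0)) (sq_nonneg y)]

lemma quadGrowth_deriv (hg : ConcaveBound L g) : QuadGrowth (deriv g) := by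
  obtain ⟨C, hC, -, hb⟩ := hg.exists_abs_deriv_le
  refine ⟨2 * C, by positivity, fun y => (hb y).trans ?_⟩
  have h3 : 1 + |y| ≤ 2 * (1 + y ^ 2) := by
    rw [← sq_abs y]; nlinarith [sq_nonneg (|y| - 1)]
  nlinarith [mul_le_mul_of_nonneg_left h3 hC]

lemma quadGrowth_deriv_deriv (hg : ConcaveBound L g) : QuadGrowth (deriv (deriv g)) := by
  have hL : 0 ≤ L := by linarith [hg.lower 0, hg.upper 0]
  refine ⟨L, hL, fun y => ?_⟩
  rw [abs_le]
  constructor <;> nlinarith [hg.lower y, hg.upper y, mul_nonneg hL (sq_nonneg y)]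

lemma quadGrowth_deriv_sq (hg : ConcaveBound L g) : QuadGrowth (fun y => deriv g y ^ 2) := by
  obtain ⟨C, hC, -, hb⟩ := hg.exists_abs_deriv_le
  refine ⟨2 * C ^ 2, by positivity, fun y => ?_⟩
  rw [abs_pow]
  have h3 : (1 + |y|) ^ 2 ≤ 2 * (1 + y ^ 2) := by
    rw [← sq_abs y]; nlinarith [sq_nonneg (|y| - 1)]
  calc |deriv g y| ^ 2 ≤ (C * (1 + |y|)) ^ 2 := pow_le_pow_left₀ (abs_nonneg _) (hb y) 2
    _ = C ^ 2 * (1 + |y|) ^ 2 := by ring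
    _ ≤ C ^ 2 * (2 * (1 + y ^ 2)) := mul_le_mul_of_nonneg_left h3 (by positivity)
    _ = _ := by ring

end ConcaveBound

lemma QuadGrowth.add {h k : ℝ → ℝ} (hh : QuadGrowth h) (hk : QuadGrowth k) :
    QuadGrowth (fun y => h y + k y) := by
  obtain ⟨C, hC, hb⟩ := hh
  obtain ⟨D, hD, hc⟩ := hk
  refine ⟨C + D, by positivity, fun y => (abs_add_le _ _).trans ?_⟩
  linarith [hb y, hc y]

lemma QuadGrowth.bdd_mul {h w : ℝ → ℝ} (hh : QuadGrowth h) {B : ℝ} (hB : 0 ≤ B)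
    (hw : ∀ y, |w y| ≤ B) : QuadGrowth (fun y => w y * h y) := by
  obtain ⟨C, hC, hb⟩ := hh
  refine ⟨B * C, by positivity, fun y => ?_⟩
  rw [abs_mul, mul_assoc]
  exact mul_le_mul (hw y) (hb y) (abs_nonneg _) hB

lemma ConcaveBound.coleHopf_of_not_pos {L m : ℝ} (hm : ¬ 0 < m) {g : ℝ → ℝ}
    (hg : ConcaveBound L g) (s : ℝ) : ConcaveBound L (coleHopf m s g) := by
  have e : coleHopf m s g = fun x => ∫ z, g (x + √s * z) ∂stdGauss := by
    ext x; simp [coleHopf, hm]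
  have d1 : ∀ y, HasDerivAt g (deriv g y) y := fun y => (hg.differentiable y).hasDerivAt
  have d2 : ∀ y, HasDerivAt (deriv g) (deriv (deriv g) y) y :=
    fun y => (hg.differentiable_deriv y).hasDerivAt
  rw [e]
  refine of_hasDerivAt
    (hasDerivAt_integral_affine d1 hg.quadGrowth hg.quadGrowth_deriv _)
    (hasDerivAt_integral_affine d2 hg.quadGrowth_deriv hg.quadGrowth_deriv_deriv _)
    (fun x => integral_nonpos fun z => hg.nonpos _) (fun x => ?_)
    (fun x => integral_nonpos fun z => hg.upper _)
  have := integral_mono (μ := stdGauss) (integrable_const (-L))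
    (hg.quadGrowth_deriv_deriv.integrable (measurable_deriv _) x √s) fun z => hg.lower _
  simpa using this

/-- Chebyshev's association inequality for a tilted Gaussian, in unnormalised form. -/
lemma integral_mul_integral_le_of_antitone {W A : ℝ → ℝ} (hA : Antitone A) (hW : ∀ z, 0 ≤ W z)
    (i0 : Integrable W stdGauss) (iA : Integrable (fun z => W z * A z) stdGauss)
    (iz : Integrable (fun z => z * W z) stdGauss)
    (izA : Integrable (fun z => z * (W z * A z)) stdGauss) (hpos : 0 < ∫ z, W z ∂stdGauss) :
    (∫ z, z * (W z * A z) ∂stdGauss) * ∫ z, W z ∂stdGauss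
      ≤ (∫ z, W z * A z ∂stdGauss) * ∫ z, z * W z ∂stdGauss := by
  set I0 := ∫ z, W z ∂stdGauss with hI0
  set J := ∫ z, z * W z ∂stdGauss with hJ
  set c := J / I0 with hc
  have h : ∫ z, W z * ((A z - A c) * (z - c)) ∂stdGauss ≤ 0 := by
    refine integral_nonpos fun z => mul_nonpos_of_nonneg_of_nonpos (hW z) ?_
    rcases le_total z c with h | h
    · exact mul_nonpos_of_nonneg_of_nonpos (by linarith [hA h]) (by linarith)
    · exact mul_nonpos_of_nonpos_of_nonneg (by linarith [hA h]) (by linarith)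
  have e : ∫ z, W z * ((A z - A c) * (z - c)) ∂stdGauss
      = (∫ z, z * (W z * A z) ∂stdGauss) - c * (∫ z, W z * A z ∂stdGauss)
        - A c * J + A c * c * I0 := by
    have i1 : Integrable (fun z => z * (W z * A z) - c * (W z * A z)) stdGauss :=
      izA.sub (iA.const_mul c)
    have i2 : Integrable (fun z => z * (W z * A z) - c * (W z * A z) - A c * (z * W z))
      stdGauss := i1.sub (iz.const_mul _)
    rw [hJ, hI0, ← integral_const_mul, ← integral_const_mul, ← integral_const_mul,
      ← integral_sub izA (iA.const_mul c), ← integral_sub i1 (iz.const_mul _),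
      ← integral_add i2 (i0.const_mul _)]
    congr 1; ext z; ring
  have hcI : c * I0 = J := div_mul_cancel₀ _ hpos.ne'
  rw [e, mul_assoc (A c), hcI] at h
  set K := ∫ z, z * (W z * A z) ∂stdGauss
  set I1 := ∫ z, W z * A z ∂stdGauss
  calc K * I0 ≤ c * I1 * I0 := mul_le_mul_of_nonneg_right (by linarith) hpos.le
    _ = I1 * (c * I0) := by ring
    _ = I1 * J := by rw [hcI]

/-- The Cauchy-Schwarz inequality for a weight `W`, in unnormalised form. -/
lemma sq_integral_mul_le {μ : Measure ℝ} {W A : ℝ → ℝ} (hW : ∀ᵐ z ∂μ, 0 ≤ W z)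
    (i0 : Integrable W μ) (iA : Integrable (fun z => W z * A z) μ)
    (iA2 : Integrable (fun z => W z * A z ^ 2) μ) (hpos : 0 < ∫ z, W z ∂μ) :
    (∫ z, W z * A z ∂μ) ^ 2 ≤ (∫ z, W z * A z ^ 2 ∂μ) * ∫ z, W z ∂μ := by
  set I0 := ∫ z, W z ∂μ with hI0
  set I1 := ∫ z, W z * A z ∂μ with hI1
  set c := I1 / I0 with hc
  have h : 0 ≤ ∫ z, W z * (A z - c) ^ 2 ∂μ :=
    integral_nonneg_of_ae (hW.mono fun z hz => mul_nonneg hz (sq_nonneg _))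
  have e : ∫ z, W z * (A z - c) ^ 2 ∂μ
      = (∫ z, W z * A z ^ 2 ∂μ) - 2 * c * I1 + c ^ 2 * I0 := by
    have i1 : Integrable (fun z => W z * A z ^ 2 - 2 * c * (W z * A z)) μ :=
      iA2.sub (iA.const_mul _)
    rw [hI1, hI0, ← integral_const_mul, ← integral_const_mul,
      ← integral_sub iA2 (iA.const_mul _), ← integral_add i1 (i0.const_mul _)]
    congr 1; ext z; ring
  have hcI : c * I0 = I1 := div_mul_cancel₀ _ hpos.ne'
  rw [e] at h
  have h2 := mul_nonneg h hpos.le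
  have h3 : (∫ z, W z * A z ^ 2 ∂μ) * I0 - 2 * (c * I0) * I1 + (c * I0) ^ 2 ≥ 0 := by linarith
  rw [hcI] at h3
  nlinarith

lemma ConcaveBound.coleHopf_of_pos {L m s : ℝ} (hm : 0 < m) (hs : 0 < s) {g : ℝ → ℝ}
    (hg : ConcaveBound L g) : ConcaveBound L (coleHopf m s g) := by
  have e : coleHopf m s g =
      fun x => (1 / m) * Real.log (∫ z, Real.exp (m * g (x + √s * z)) ∂stdGauss) := by
    ext x; simp [coleHopf, hm]
  set r := √s with hr
  have hr0 : 0 < r := Real.sqrt_pos.2 hs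
  have d1 : ∀ y, HasDerivAt g (deriv g y) y := fun y => (hg.differentiable y).hasDerivAt
  have d2 : ∀ y, HasDerivAt (deriv g) (deriv (deriv g) y) y :=
    fun y => (hg.differentiable_deriv y).hasDerivAt
  set E : ℝ → ℝ := fun y => Real.exp (m * g y) with hE
  have hE0 : ∀ y, 0 ≤ E y := fun y => (Real.exp_pos _).le
  have hE1 : ∀ y, E y ≤ 1 := fun y =>
    Real.exp_le_one_iff.2 (mul_nonpos_of_nonneg_of_nonpos hm.le (hg.nonpos y))
  have hEb : ∀ y, |E y| ≤ 1 := fun y => by rw [abs_of_nonneg (hE0 y)]; exact hE1 y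
  have dE : ∀ y, HasDerivAt E (m * (E y * deriv g y)) y := fun y =>
    ((d1 y).const_mul m).exp.congr_deriv (by simp only [hE]; ring)
  have dEg : ∀ y, HasDerivAt (fun y => E y * deriv g y)
      (E y * deriv (deriv g) y + m * (E y * deriv g y ^ 2)) y := fun y =>
    ((dE y).mul (d2 y)).congr_deriv (by ring)
  have qE : QuadGrowth E := ⟨1, zero_le_one, fun y => (hEb y).trans (by nlinarith [sq_nonneg y])⟩
  have qEg : QuadGrowth (fun y => E y * deriv g y) :=
    hg.quadGrowth_deriv.bdd_mul zero_le_one hEb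
  have qEg2 : QuadGrowth (fun y => E y * deriv g y ^ 2) :=
    hg.quadGrowth_deriv_sq.bdd_mul zero_le_one hEb
  have qEgg : QuadGrowth (fun y => E y * deriv (deriv g) y) :=
    hg.quadGrowth_deriv_deriv.bdd_mul zero_le_one hEb
  have qmEg : QuadGrowth (fun y => m * (E y * deriv g y)) :=
    qEg.bdd_mul hm.le fun _ => (abs_of_pos hm).le
  have qmEg2 : QuadGrowth (fun y => m * (E y * deriv g y ^ 2)) :=
    qEg2.bdd_mul hm.le fun _ => (abs_of_pos hm).le
  have mE : Measurable E := (continuous_of_hasDerivAt dE).measurable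
  have mg' : Measurable (deriv g) := measurable_deriv g
  have mg'' : Measurable (deriv (deriv g)) := measurable_deriv _
  set I0 : ℝ → ℝ := fun x => ∫ z, E (x + r * z) ∂stdGauss with hI0
  set I1 : ℝ → ℝ := fun x => ∫ z, E (x + r * z) * deriv g (x + r * z) ∂stdGauss with hI1
  set M : ℝ → ℝ := fun x => ∫ z, (E (x + r * z) * deriv (deriv g) (x + r * z)
    + m * (E (x + r * z) * deriv g (x + r * z) ^ 2)) ∂stdGauss with hM
  have iE := fun x => qE.integrable mE x r
  have iEg := fun x => qEg.integrable (mE.mul mg') x r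
  have iEg2 := fun x => qEg2.integrable (mE.mul (mg'.pow_const 2)) x r
  have iEgg := fun x => qEgg.integrable (mE.mul mg'') x r
  have pos : ∀ x, 0 < I0 x := fun x => by
    have := integral_exp_pos (μ := stdGauss) (f := fun z => m * g (x + r * z)) (iE x)
    exact this
  have D0 : ∀ x, HasDerivAt I0 (m * I1 x) x := fun x => by
    have := hasDerivAt_integral_affine dE qE qmEg r x
    rwa [integral_const_mul] at this
  have D1 : ∀ x, HasDerivAt I1 (M x) x :=
    hasDerivAt_integral_affine dEg qEg (qEgg.add qmEg2) r
  rw [e]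
  refine of_hasDerivAt (g' := fun x => I1 x / I0 x)
    (g'' := fun x => (M x * I0 x - I1 x * (m * I1 x)) / I0 x ^ 2)
    (fun x => ?_) (fun x => (D1 x).div (D0 x) (pos x).ne') (fun x => ?_) (fun x => ?_)
    (fun x => ?_)
  · refine (((D0 x).log (pos x).ne').const_mul (1 / m)).congr_deriv ?_
    field_simp
  · refine mul_nonpos_of_nonneg_of_nonpos (by positivity) (Real.log_nonpos (pos x).le ?_)
    have := integral_mono (μ := stdGauss) (iE x) (integrable_const 1) fun z => hE1 _
    simpa using this
  · rw [le_div_iff₀ (pow_pos (pos x) 2)]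
    have h1 := sq_integral_mul_le (μ := stdGauss) (W := fun z => E (x + r * z))
      (A := fun z => deriv g (x + r * z)) (ae_of_all _ fun z => hE0 _) (iE x) (iEg x) (iEg2 x)
      (pos x)
    have h2 : -L * I0 x ≤ ∫ z, E (x + r * z) * deriv (deriv g) (x + r * z) ∂stdGauss := by
      rw [hI0, ← integral_const_mul]
      refine integral_mono ((iE x).const_mul _) (iEgg x) fun z => ?_
      have := mul_le_mul_of_nonneg_left (hg.lower (x + r * z)) (hE0 (x + r * z))
      simp only; linarith
    have h3 : M x = (∫ z, E (x + r * z) * deriv (deriv g) (x + r * z) ∂stdGauss)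
        + m * ∫ z, E (x + r * z) * deriv g (x + r * z) ^ 2 ∂stdGauss := by
      rw [hM, ← integral_const_mul, ← integral_add (iEgg x) ((iEg2 x).const_mul m)]
    have h4 := mul_le_mul_of_nonneg_right h2 (pos x).le
    have h5 := mul_le_mul_of_nonneg_left h1 hm.le
    rw [h3]
    change m * I1 x ^ 2 ≤ m * (_ * I0 x) at h5
    nlinarith
  · refine div_nonpos_of_nonpos_of_nonneg ?_ (sq_nonneg _)
    have h1 := integral_mul_integral_le_of_antitone (W := fun z => E (x + r * z))
      (A := fun z => deriv g (x + r * z))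
      (fun a b hab => hg.antitone_deriv (by nlinarith)) (fun z => hE0 _) (iE x) (iEg x)
      (qE.integrable_id_mul mE x r) (qEg.integrable_id_mul (mE.mul mg') x r) (pos x)
    rw [integral_id_mul_stdGauss dEg qEg (qEgg.add qmEg2) x r,
      integral_id_mul_stdGauss dE qE qmEg x r, integral_const_mul] at h1
    change r * M x * I0 x ≤ I1 x * (r * (m * I1 x)) at h1
    have : r * (M x * I0 x - I1 x * (m * I1 x)) ≤ 0 := by linarith
    exact nonpos_of_mul_nonpos_right this hr0

lemma ConcaveBound.coleHopf {L s : ℝ} (m : ℝ) (hs : 0 < s) {g : ℝ → ℝ}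
    (hg : ConcaveBound L g) : ConcaveBound L (coleHopf m s g) := by
  by_cases hm : 0 < m
  · exact hg.coleHopf_of_pos hm hs
  · exact hg.coleHopf_of_not_pos hm s

lemma gaussTail_eq_integral (v : ℝ) : gaussTail v = ∫ z in Set.Ioi v, φ z := by
  rw [gaussTail, stdGauss, gaussianReal_apply_eq_integral _ one_ne_zero,
    integral_Ici_eq_integral_Ioi, ENNReal.toReal_ofReal]
  exact integral_nonneg fun z => gaussianPDFReal_nonneg _ _ _

lemma gaussTail_pos (v : ℝ) : 0 < gaussTail v := by
  rw [gaussTail_eq_integral, integral_pos_iff_support_of_nonneg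
    (fun z => gaussianPDFReal_nonneg _ _ _) (integrable_gaussianPDFReal 0 1).integrableOn]
  have : Function.support φ = Set.univ :=
    Set.eq_univ_of_forall fun z => (gaussianPDFReal_pos 0 1 z one_ne_zero).ne'
  simp [this]

lemma gaussTail_le_one (v : ℝ) : gaussTail v ≤ 1 := by
  have h : stdGauss (Set.Ici v) ≤ 1 := prob_le_one
  exact ENNReal.toReal_le_of_le_ofReal zero_le_one (by simpa using h)

lemma continuous_gaussianPDFReal : Continuous φ :=
  continuous_of_hasDerivAt hasDerivAt_gaussianPDFReal

lemma hasDerivAt_gaussTail (v : ℝ) : HasDerivAt gaussTail (-φ v) v := by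
  have hi : Integrable φ := integrable_gaussianPDFReal 0 1
  have e : gaussTail = fun v => (∫ z in Set.Ioi 0, φ z) - ∫ z in (0 : ℝ)..v, φ z := by
    ext v
    rw [gaussTail_eq_integral, ← intervalIntegral.integral_interval_add_Ioi
      (hi.integrableOn (s := Set.Ioi 0)) (hi.integrableOn (s := Set.Ioi v))]
    ring
  rw [e]
  exact (continuous_gaussianPDFReal.integral_hasStrictDerivAt 0 v).hasDerivAt.const_sub _

lemma integrable_gaussianPDFReal_mul_id : Integrable (fun z => φ z * z) :=
  (integrable_stdGauss_iff _).1 ((memLp_id_gaussianReal 1).integrable (by simp))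

lemma integrable_gaussianPDFReal_mul_sq : Integrable (fun z => φ z * z ^ 2) :=
  (integrable_stdGauss_iff _).1 (memLp_id_gaussianReal 2).integrable_sq

lemma setIntegral_Ioi_gaussianPDFReal_mul_id (v : ℝ) : ∫ z in Set.Ioi v, φ z * z = φ v := by
  have hd : ∀ z, HasDerivAt (fun z => -φ z) (φ z * z) z := fun z =>
    (hasDerivAt_gaussianPDFReal z).neg.congr_deriv (by ring)
  have hi := integrable_gaussianPDFReal_mul_id.integrableOn (s := Set.Ioi v)
  have ht := tendsto_zero_of_hasDerivAt_of_integrableOn_Ioi (a := v) (fun z _ => hd z) hi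
    (integrable_gaussianPDFReal 0 1).neg.integrableOn
  rw [integral_Ioi_of_hasDerivAt_of_tendsto' (fun z _ => hd z) hi ht]
  ring

lemma setIntegral_Ioi_gaussianPDFReal_mul_sq (v : ℝ) :
    ∫ z in Set.Ioi v, φ z * z ^ 2 = gaussTail v + v * φ v := by
  have hd : ∀ z, HasDerivAt (fun z => -(φ z * z)) (φ z * z ^ 2 - φ z) z := fun z =>
    ((hasDerivAt_gaussianPDFReal z).mul (hasDerivAt_id z)).neg.congr_deriv
      (by simp only [id]; ring)
  have i2 := integrable_gaussianPDFReal_mul_sq.integrableOn (s := Set.Ioi v)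
  have i0 := (integrable_gaussianPDFReal 0 1).integrableOn (s := Set.Ioi v)
  have ht := tendsto_zero_of_hasDerivAt_of_integrableOn_Ioi (a := v) (fun z _ => hd z)
    (i2.sub i0) integrable_gaussianPDFReal_mul_id.neg.integrableOn
  have h := integral_Ioi_of_hasDerivAt_of_tendsto' (fun z _ => hd z) (i2.sub i0) ht
  rw [integral_sub i2 i0, ← gaussTail_eq_integral] at h
  linarith

/-- Upper bound on the Gaussian tail (Mills ratio). -/
lemma mul_gaussTail_le (v : ℝ) : v * gaussTail v ≤ φ v := by
  rw [← setIntegral_Ioi_gaussianPDFReal_mul_id v, gaussTail_eq_integral, ← integral_const_mul]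
  refine setIntegral_mono_on ((integrable_gaussianPDFReal 0 1).const_mul v).integrableOn
    integrable_gaussianPDFReal_mul_id.integrableOn measurableSet_Ioi fun z hz => ?_
  have hz' : v < z := hz
  nlinarith [gaussianPDFReal_nonneg 0 1 z]

/-- Lower bound on the Gaussian tail: the variance of a truncated Gaussian is nonnegative. -/
lemma gaussianPDFReal_sq_le (v : ℝ) :
    φ v ^ 2 ≤ (gaussTail v + v * φ v) * gaussTail v := by
  have h := sq_integral_mul_le (μ := volume.restrict (Set.Ioi v)) (W := φ) (A := fun z => z)
    (ae_of_all _ fun z => gaussianPDFReal_nonneg _ _ _)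
    (integrable_gaussianPDFReal 0 1).integrableOn
    integrable_gaussianPDFReal_mul_id.integrableOn
    integrable_gaussianPDFReal_mul_sq.integrableOn
    (by rw [← gaussTail_eq_integral]; exact gaussTail_pos v)
  rwa [setIntegral_Ioi_gaussianPDFReal_mul_id, setIntegral_Ioi_gaussianPDFReal_mul_sq,
    ← gaussTail_eq_integral] at h

lemma concaveBound_log_gaussTail (κ : ℝ) {s : ℝ} (hs : 0 < s) :
    ConcaveBound (1 / s) (fun x => Real.log (gaussTail ((κ - x) / √s))) := by
  set r := √s with hr
  have hr0 : 0 < r := Real.sqrt_pos.2 hs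
  have hrs : s = r ^ 2 := (Real.sq_sqrt hs.le).symm
  have dv : ∀ x, HasDerivAt (fun x => (κ - x) / r) (-1 / r) x := fun x =>
    ((hasDerivAt_id x).const_sub κ).div_const r
  have dG : ∀ x, HasDerivAt (fun x => gaussTail ((κ - x) / r)) (φ ((κ - x) / r) / r) x :=
    fun x => ((hasDerivAt_gaussTail _).comp x (dv x)).congr_deriv (by ring)
  have dφ : ∀ x, HasDerivAt (fun x => φ ((κ - x) / r) / r)
      ((κ - x) / r * φ ((κ - x) / r) / r / r) x :=
    fun x => (((hasDerivAt_gaussianPDFReal _).comp x (dv x)).div_const r).congr_deriv (by ring)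
  refine ConcaveBound.of_hasDerivAt (fun x => (dG x).log (gaussTail_pos _).ne')
    (fun x => (dφ x).div (dG x) (gaussTail_pos _).ne')
    (fun x => Real.log_nonpos (gaussTail_pos _).le (gaussTail_le_one _)) (fun x => ?_)
    (fun x => ?_)
  all_goals
    set v := (κ - x) / r
    have hG := gaussTail_pos v
    have hφ := gaussianPDFReal_nonneg 0 1 v
    have e : (v * φ v / r / r * gaussTail v - φ v / r * (φ v / r)) / gaussTail v ^ 2
      = (v * φ v * gaussTail v - φ v ^ 2) / (gaussTail v ^ 2 * s) := by
      rw [hrs]; field_simp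
    rw [e]
  · rw [le_div_iff₀ (by positivity)]
    have h := gaussianPDFReal_sq_le v
    have : -(1 / s) * (gaussTail v ^ 2 * s) = -gaussTail v ^ 2 := by field_simp
    rw [this]; nlinarith
  · refine div_nonpos_of_nonpos_of_nonneg ?_ (by positivity)
    nlinarith [mul_le_mul_of_nonneg_left (mul_gaussTail_le v) hφ]

namespace StepFn

lemma qbar_lt_one (γ : StepFn) : γ.qbar < 1 := by
  have h := γ.q_lt γ.n le_rfl
  rwa [γ.q_last] at h

lemma concaveBound_PhiAux_zero (γ : StepFn) (κ : ℝ) :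
    ConcaveBound (1 / (1 - γ.qbar)) (γ.PhiAux κ 0 (γ.q γ.n)) :=
  concaveBound_log_gaussTail κ (s := 1 - γ.qbar) (by linarith [γ.qbar_lt_one])

lemma concaveBound_PhiAux (γ : StepFn) (κ : ℝ) {j : ℕ} (hj : j ≤ γ.n) :
    ConcaveBound (1 / (1 - γ.qbar)) (γ.PhiAux κ j (γ.q (γ.n - j))) := by
  induction j with
  | zero => exact γ.concaveBound_PhiAux_zero κ
  | succ j ih =>
    refine (ih (by omega)).coleHopf _ (sub_pos.2 ?_)
    have h := γ.q_lt (γ.n - (j + 1)) (by omega)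
    rwa [show γ.n - (j + 1) + 1 = γ.n - j by omega] at h

lemma concaveBound_Phi (γ : StepFn) (κ : ℝ) {t : ℝ} (ht : t ∈ Set.Icc (0 : ℝ) γ.qbar) :
    ConcaveBound (1 / (1 - γ.qbar)) (γ.Phi κ t) := by
  classical
  have hex : ∃ i ≤ γ.n, γ.Phi κ t = γ.PhiAux κ (γ.n - i) t ∧ γ.q i ≤ t ∧
      (i < γ.n → t < γ.q (i + 1)) := by
    refine ⟨Nat.findGreatest (fun i => γ.q i ≤ t) γ.n, Nat.findGreatest_le _, ?_, ?_, ?_⟩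
    · ext x; unfold Phi; congr!
    · exact Nat.findGreatest_spec (P := fun i => γ.q i ≤ t) (Nat.zero_le γ.n)
        (by rw [γ.q_zero]; exact ht.1)
    · intro hi
      exact not_le.1 (Nat.findGreatest_is_greatest (P := fun i => γ.q i ≤ t)
        (Nat.lt_succ_self _) hi)
  obtain ⟨i, hi, e, h1, h2⟩ := hex
  rw [e]
  rcases hi.eq_or_lt with rfl | hlt
  · rw [Nat.sub_self, show t = γ.q γ.n from le_antisymm ht.2 h1]
    exact γ.concaveBound_PhiAux_zero κ
  · obtain ⟨j, hj⟩ : ∃ j, γ.n - i = j + 1 := ⟨γ.n - i - 1, by omega⟩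
    rw [hj]
    refine (γ.concaveBound_PhiAux κ (j := j) (by omega)).coleHopf _ (sub_pos.2 ?_)
    rw [show γ.n - j = i + 1 by omega]
    exact h2 hlt

end StepFn

/-- Proposition 4.1, Eq. (4.9): for `γ ∈ SF⁺` and every `t ∈ [0,q̄]`,
the function `x ↦ Φ_γ(t,x)` is twice differentiable with
`−1/(1−q̄) ≤ ∂ₓ²Φ_γ(t,x) ≤ 0` for all `x`; in particular it is concave. -/
theorem statement_3 (κ : ℝ) (γ : StepFn) :
    ∀ t ∈ Set.Icc (0 : ℝ) γ.qbar,
      Differentiable ℝ (fun x => γ.Phi κ t x) ∧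
      Differentiable ℝ (deriv (fun x => γ.Phi κ t x)) ∧
      (∀ x : ℝ,
        -(1 / (1 - γ.qbar)) ≤ deriv (deriv (fun y => γ.Phi κ t y)) x ∧
        deriv (deriv (fun y => γ.Phi κ t y)) x ≤ 0) ∧
      ConcaveOn ℝ Set.univ (fun x => γ.Phi κ t x) := by
  intro t ht
  have h := γ.concaveBound_Phi κ ht
  exact ⟨h.differentiable, h.differentiable_deriv, fun x => ⟨h.lower x, h.upper x⟩,
    concaveOn_univ_of_deriv2_nonpos h.differentiable h.differentiable_deriv h.upper⟩
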